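/- Minimality of Hamilton's action for the free trajectory in a linear potential (Corollary): let F be a real inner product space, m > 0, g, x₀, v₀ ∈ F, V₀ ∈ ℝ, and t₁ < t₃ real numbers. Let x(t) = x₀ + t•v₀ − (t²/(2m))•g and V(y) = V₀ + ⟪g, y⟫. If y : ℝ → F has derivative y'(t) at every t ∈ [t₁, t₃], y' is continuous on [t₁, t₃], and y(t₁) = x(t₁) and y(t₃) = x(t₃), then ∫_{t₁}^{t₃} (m/2·‖y'(t)‖² − V(y(t))) dt ≥ ∫_{t₁}^{t₃} (m/2·‖x'(t)‖² − V(x(t))) dt, with equality if and only if y(t) = x(t) for all t ∈ [t₁, t₃]. In the free-running course of the intrinsic action — no exterior steering — Hamilton's quantity of action is minimal. -/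

import Mathlib

open MeasureTheory RealInnerProductSpace

/-- Energy identity around the free trajectory: the action of a path with the same endpoints
exceeds that of the free trajectory exactly by the kinetic energy of the deviation. -/
theorem action_sub_action_free_eq {F : Type*} [NormedAddCommGroup F] [InnerProductSpace ℝ F]
    {m : ℝ} (hm : m ≠ 0) {g : F} {V₀ t₁ t₃ : ℝ} (ht : t₁ ≤ t₃) {x x' y y' : ℝ → F}
    (hx : ∀ t ∈ Set.Icc t₁ t₃, HasDerivAt x (x' t) t)
    (hx' : ∀ t ∈ Set.Icc t₁ t₃, HasDerivAt x' (-(m⁻¹ • g)) t)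
    (hy : ∀ t ∈ Set.Icc t₁ t₃, HasDerivAt y (y' t) t)
    (hy' : ContinuousOn y' (Set.Icc t₁ t₃))
    (h₁ : y t₁ = x t₁) (h₃ : y t₃ = x t₃) :
    (∫ t in t₁..t₃, (m / 2 * ‖y' t‖ ^ 2 - (V₀ + ⟪g, y t⟫))) -
        (∫ t in t₁..t₃, (m / 2 * ‖x' t‖ ^ 2 - (V₀ + ⟪g, x t⟫))) =
      ∫ t in t₁..t₃, m / 2 * ‖y' t - x' t‖ ^ 2 := by
  have hcx : ContinuousOn x (Set.Icc t₁ t₃) := HasDerivAt.continuousOn hx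
  have hcx' : ContinuousOn x' (Set.Icc t₁ t₃) := HasDerivAt.continuousOn hx'
  have hcy : ContinuousOn y (Set.Icc t₁ t₃) := HasDerivAt.continuousOn hy
  have intble : ∀ {f : ℝ → ℝ}, ContinuousOn f (Set.Icc t₁ t₃) →
      IntervalIntegrable f volume t₁ t₃ :=
    fun hf => hf.intervalIntegrable_of_Icc ht
  have hB : ∫ t in t₁..t₃, m * (⟪x' t, y' t - x' t⟫ + ⟪-(m⁻¹ • g), y t - x t⟫) = 0 := by
    rw [intervalIntegral.integral_eq_sub_of_hasDerivAt
      (f := fun t => m * ⟪x' t, y t - x t⟫)]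
    · simp [h₁, h₃]
    · intro t htm
      rw [Set.uIcc_of_le ht] at htm
      exact ((hx' t htm).inner ℝ ((hy t htm).sub (hx t htm))).const_mul m
    · exact intble (by fun_prop)
  rw [← intervalIntegral.integral_sub (intble (by fun_prop)) (intble (by fun_prop)),
    ← sub_eq_zero, ← intervalIntegral.integral_sub
      (intble (by fun_prop)) (intble (by fun_prop)), ← hB]
  congr 1 with t
  have hn := norm_sub_sq_real (y' t) (x' t)
  rw [hn, inner_sub_right, inner_neg_left, inner_smul_left, inner_sub_right,
    real_inner_self_eq_norm_sq, real_inner_comm (y' t) (x' t)]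
  simp only [conj_trivial]
  field_simp
  ring

/-- A path differentiable on `[a, b]` and vanishing at `a` vanishes on `[a, b]` exactly when the
integral of its squared speed is zero. -/
theorem integral_sq_norm_deriv_eq_zero_iff {F : Type*} [NormedAddCommGroup F] [NormedSpace ℝ F]
    {a b : ℝ} (hab : a < b) {u u' : ℝ → F}
    (hu : ∀ t ∈ Set.Icc a b, HasDerivAt u (u' t) t)
    (hu' : ContinuousOn u' (Set.Icc a b)) (ha : u a = 0) :
    ∫ t in a..b, ‖u' t‖ ^ 2 = 0 ↔ ∀ t ∈ Set.Icc a b, u t = 0 := by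
  constructor
  · intro h
    have hzero : ∀ t ∈ Set.Icc a b, u' t = 0 := by
      by_contra! hne
      obtain ⟨c, hc, hc0⟩ := hne
      exact (intervalIntegral.integral_pos hab (by fun_prop)
        (fun t _ => by positivity) ⟨c, hc, by positivity⟩).ne' h
    intro t htm
    rw [← ha]
    refine constant_of_has_deriv_right_zero (HasDerivAt.continuousOn hu) (fun s hs => ?_) t htm
    have hs' := Set.Ico_subset_Icc_self hs
    simpa [hzero s hs'] using (hu s hs').hasDerivWithinAt
  · intro h
    have hzero : ∀ t ∈ Set.Icc a b, u' t = 0 := fun t htm =>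
      (uniqueDiffOn_Icc hab t htm).eq_deriv _ (hu t htm).hasDerivWithinAt
        ((hasDerivWithinAt_const t _ (0 : F)).congr h (h t htm))
    rw [intervalIntegral.integral_congr (g := fun _ => (0 : ℝ)) fun t htm => ?_]
    · simp
    · rw [Set.uIcc_of_le hab.le] at htm
      simp [hzero t htm]

/-- Minimality of Hamilton's action for the free trajectory in a linear potential: among all
paths `y` with the same endpoints, the free trajectory `x` minimizes Hamilton's action, with
equality iff `y` coincides with `x` on `[t₁, t₃]`. -/
theorem hamilton_action_minimal_free_trajectory {F : Type*} [NormedAddCommGroup F]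
    [InnerProductSpace ℝ F]
    (m : ℝ) (hm : 0 < m) (g x₀ v₀ : F) (V₀ : ℝ) (t₁ t₃ : ℝ) (ht : t₁ < t₃)
    (x x' : ℝ → F)
    (hx : ∀ t : ℝ, x t = x₀ + t • v₀ - (t ^ 2 / (2 * m)) • g)
    (hx' : ∀ t : ℝ, x' t = v₀ - (t / m) • g)
    (V : F → ℝ) (hV : ∀ y : F, V y = V₀ + ⟪g, y⟫)
    (y y' : ℝ → F)
    (hy : ∀ t ∈ Set.Icc t₁ t₃, HasDerivAt y (y' t) t)
    (hy' : ContinuousOn y' (Set.Icc t₁ t₃))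
    (h₁ : y t₁ = x t₁) (h₃ : y t₃ = x t₃) :
    (∫ t in t₁..t₃, (m / 2 * ‖x' t‖ ^ 2 - V (x t))) ≤
        (∫ t in t₁..t₃, (m / 2 * ‖y' t‖ ^ 2 - V (y t))) ∧
      ((∫ t in t₁..t₃, (m / 2 * ‖y' t‖ ^ 2 - V (y t))) =
          (∫ t in t₁..t₃, (m / 2 * ‖x' t‖ ^ 2 - V (x t))) ↔
        ∀ t ∈ Set.Icc t₁ t₃, y t = x t) := by
  have hdx : ∀ t, HasDerivAt x (x' t) t := by
    intro t
    rw [funext hx, hx']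
    have h := (((hasDerivAt_id t).smul_const v₀).const_add x₀).sub
      ((((hasDerivAt_id t).pow 2).div_const (2 * m)).smul_const g)
    have hcoeff : v₀ - (t / m) • g =
        (1 : ℝ) • v₀ - (((2 : ℕ) : ℝ) * id t ^ (2 - 1) * 1 / (2 * m)) • g := by
      simp [mul_div_mul_left]
    rw [hcoeff]
    exact h
  have hdx' : ∀ t, HasDerivAt x' (-(m⁻¹ • g)) t := by
    intro t
    rw [funext hx']
    simpa using (((hasDerivAt_id t).div_const m).smul_const g).const_sub v₀
  have hcx' : ContinuousOn x' (Set.Icc t₁ t₃) := HasDerivAt.continuousOn fun t _ => hdx' t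
  have key := action_sub_action_free_eq (V₀ := V₀) hm.ne' ht.le (fun t _ => hdx t)
    (fun t _ => hdx' t) hy hy' h₁ h₃
  rw [intervalIntegral.integral_const_mul] at key
  have hiff := integral_sq_norm_deriv_eq_zero_iff ht
    (fun t htm => (hy t htm).sub (hdx t)) (hy'.sub hcx') (sub_eq_zero.2 h₁)
  simp only [hV]
  refine ⟨sub_nonneg.1 (key ▸ mul_nonneg (by positivity)
    (intervalIntegral.integral_nonneg ht.le fun t _ => by positivity)), ?_⟩
  rw [← sub_eq_zero, key, mul_eq_zero, or_iff_right (by positivity)]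
  simpa [sub_eq_zero] using hiff
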